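/- arXiv:2410.04127 — 2 statements merged into one kernel-verified Lean document; each statement's English description precedes it below -/
import Mathlib

section
/- Let P be a finite poset and f : P → P an order-preserving map such that x ≤ f(x) for all x ∈ P and f(f(x)) = f(x) for all x. Then the order complex of P is homotopy equivalent to the order complex of the image f(P). -/
open CategoryTheory

/-- The geometric realization of the order complex of a poset, modelled as the
geometric realization of the nerve of the poset viewed as a category.  (The nerve of a
poset is the simplicial set whose nondegenerate simplices are the chains of the poset,
i.e. its order complex.) -/
noncomputable def orderComplexSpace (P : Type) [PartialOrder P] : TopCat :=
  SSet.toTop.obj (nerve P)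

namespace OC
open Simplicial Opposite

/-- the characteristic map of a simplex -/
noncomputable def phi (X : SSet.{0}) {n : ℕ} (x : X _⦋n⦌) :
    C(stdSimplex ℝ (Fin (n + 1)), SSet.toTop.obj X) :=
  TopCat.toSSetObjEquiv _ (op ⦋n⦌) ((sSetTopAdj.unit.app X).app _ x)

lemma phi_map (X : SSet.{0}) {n m : ℕ} (θ : (⦋n⦌ : SimplexCategory) ⟶ ⦋m⦌) (x : X _⦋m⦌)
    (t : stdSimplex ℝ (Fin (n + 1))) :
    phi X (X.map θ.op x) t = phi X x (stdSimplex.map θ t) := by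
  have h := NatTrans.naturality_apply (sSetTopAdj.unit.app X) θ.op x
  exact congrArg (fun s => TopCat.toSSetObjEquiv (SSet.toTop.obj X) (op ⦋n⦌) s t) h

lemma phi_σ (X : SSet.{0}) {n : ℕ} (i : Fin (n + 1)) (x : X _⦋n⦌)
    (t : stdSimplex ℝ (Fin (n + 2))) :
    phi X (X.σ i x) t = phi X x (stdSimplex.map i.predAbove t) :=
  phi_map X (SimplexCategory.σ i) x t

lemma phi_δ (X : SSet.{0}) {n : ℕ} (i : Fin (n + 2)) (x : X _⦋n+1⦌)
    (t : stdSimplex ℝ (Fin (n + 1))) :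
    phi X (X.δ i x) t = phi X x (stdSimplex.map i.succAbove t) :=
  phi_map X (SimplexCategory.δ i) x t

lemma homEquiv_phi {X : SSet.{0}} {Y : TopCat.{0}} (g : SSet.toTop.obj X ⟶ Y) {n : ℕ} (x : X _⦋n⦌)
    (t : stdSimplex ℝ (Fin (n + 1))) :
    TopCat.toSSetObjEquiv _ (op ⦋n⦌) ((sSetTopAdj.homEquiv X Y g).app _ x) t
      = g (phi X x t) := by
  rw [Adjunction.homEquiv_unit]
  rfl

lemma hom_ext {X : SSet.{0}} {Y : TopCat.{0}} {g h : SSet.toTop.obj X ⟶ Y}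
    (H : ∀ (n : ℕ) (x : X _⦋n⦌) t, g (phi X x t) = h (phi X x t)) : g = h := by
  apply (sSetTopAdj.homEquiv X Y).injective
  ext ⟨⟨n⟩⟩ x
  apply (TopCat.toSSetObjEquiv _ (op ⦋n⦌)).injective
  ext t
  exact (homEquiv_phi g x t).trans ((H n x t).trans (homEquiv_phi h x t).symm)

lemma phi_surj {X : SSet.{0}} (z : SSet.toTop.obj X) :
    ∃ (n : ℕ) (x : X _⦋n⦌) (t : _), phi X x t = z := by
  let : TopologicalSpace Prop := ⊤
  let Y : TopCat.{0} := TopCat.of Prop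
  let g : SSet.toTop.obj X ⟶ Y := TopCat.ofHom
    ⟨fun z => ∃ (n : ℕ) (x : X _⦋n⦌) (t : _), phi X x t = z, continuous_top⟩
  let h : SSet.toTop.obj X ⟶ Y := TopCat.ofHom ⟨fun z => True, continuous_top⟩
  have : g = h := hom_ext (fun n x t => eq_true ⟨n, x, t, rfl⟩)
  have h2 : g z = h z := by rw [this]
  exact of_eq_true h2

section
variable {P : Type} [PartialOrder P]

lemma map_apply {X Y : Type} [Fintype X] [Fintype Y] [DecidableEq Y] (f : X → Y)
    (s : stdSimplex ℝ X) (y : Y) :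
    stdSimplex.map f s y = ∑ x with f x = y, s x := by
  rw [stdSimplex.map_coe, FunOnFinite.linearMap_apply_apply]

lemma map_inj_apply {X Y : Type} [Fintype X] [Fintype Y] (f : X → Y)
    (hf : Function.Injective f)
    (s : stdSimplex ℝ X) (x : X) :
    stdSimplex.map f s (f x) = s x := by
  classical
  rw [map_apply, Finset.sum_eq_single x]
  · intro b hb hb'
    exact absurd (hf (by simpa using hb)) hb'
  · simp

lemma map_ne_zero {X Y : Type} [Fintype X] [Fintype Y] (f : X → Y)
    (s : stdSimplex ℝ X) (y : Y) : stdSimplex.map f s y ≠ 0 ↔ ∃ x, f x = y ∧ s x ≠ 0 := by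
  classical
  rw [map_apply, Ne, Finset.sum_eq_zero_iff_of_nonneg (fun i _ => stdSimplex.zero_le s i)]
  simp

lemma exists_of_zero {n : ℕ} (t : stdSimplex ℝ (Fin (n + 2))) (i : Fin (n + 2)) (h : t i = 0) :
    ∃ t' : stdSimplex ℝ (Fin (n + 1)), stdSimplex.map i.succAbove t' = t := by
  have hs : ∑ j, t j = 1 := stdSimplex.sum_eq_one t
  rw [Fin.sum_univ_succAbove _ i, h, zero_add] at hs
  refine ⟨⟨fun j => t (i.succAbove j), fun j => stdSimplex.zero_le t _, hs⟩, ?_⟩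
  ext k
  rcases Fin.eq_self_or_eq_succAbove i k with rfl | ⟨j, rfl⟩
  · rw [h]
    by_contra hne
    obtain ⟨j, hj, _⟩ := (map_ne_zero _ _ _).1 hne
    exact Fin.succAbove_ne _ _ hj
  · rw [map_inj_apply _ Fin.succAbove_right_injective]; rfl

lemma canonical (n : ℕ) : ∀ (x : (nerve P) _⦋n⦌) (t : stdSimplex ℝ (Fin (n + 1))),
    ∃ (m : ℕ) (y : (nerve P) _⦋m⦌) (u : stdSimplex ℝ (Fin (m + 1))),
      StrictMono y.obj ∧ (∀ i, u i ≠ 0) ∧ phi (nerve P) y u = phi (nerve P) x t := by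
  induction n with
  | zero =>
    intro x t
    refine ⟨0, x, t, ?_, ?_, rfl⟩
    · exact Subsingleton.strictMono (α := Fin 1) _
    · intro i
      have := stdSimplex.eq_one_of_unique (X := Fin 1) t i
      rw [this]; exact one_ne_zero
  | succ n ih =>
    intro x t
    by_cases hx : StrictMono x.obj
    · by_cases ht : ∀ i, t i ≠ 0
      · exact ⟨_, x, t, hx, ht, rfl⟩
      · push Not at ht
        obtain ⟨i, hi⟩ := ht
        obtain ⟨t', rfl⟩ := exists_of_zero t i hi
        rw [← phi_δ]
        exact ih _ _
    · rw [← PartialOrder.mem_nerve_nonDegenerate_iff_strictMono,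
        ← SSet.mem_degenerate_iff_notMem_nonDegenerate, SSet.degenerate_eq_iUnion_range_σ,
        Set.mem_iUnion] at hx
      obtain ⟨i, y, rfl⟩ := hx
      rw [phi_σ]
      exact ih _ _

variable [Fintype P]

variable (P) in
/-- Concrete geometric realization of the order complex. -/
def K : Type := {w : stdSimplex ℝ P // IsChain (· ≤ ·) {p | w p ≠ 0}}

instance : TopologicalSpace (K P) := inferInstanceAs (TopologicalSpace {_w : stdSimplex ℝ P // _})
instance : T2Space (K P) := inferInstanceAs (T2Space {_w : stdSimplex ℝ P // _})

lemma chain_map {X : Type} [PartialOrder X] [Fintype X] (f : X → P) (hf : Monotone f)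
    (t : stdSimplex ℝ X) (ht : IsChain (· ≤ ·) {p | t p ≠ 0}) :
    IsChain (· ≤ ·) {p | stdSimplex.map f t p ≠ 0} := by
  intro a ha b hb _
  obtain ⟨x, rfl, hx⟩ := (map_ne_zero _ _ _).1 ha
  obtain ⟨y, rfl, hy⟩ := (map_ne_zero _ _ _).1 hb
  rcases ht.total hx hy with h | h
  · exact Or.inl (hf h)
  · exact Or.inr (hf h)

/-- Pushforward. -/
noncomputable def push {X : Type} [PartialOrder X] [Fintype X] (f : X → P) (hf : Monotone f) :
    C(K X, K P) :=
  ⟨fun w => ⟨stdSimplex.map f w.1, chain_map f hf _ w.2⟩,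
    Continuous.subtype_mk ((stdSimplex.continuous_map f).comp continuous_subtype_val) _⟩

/-- Affine simplex. -/
noncomputable def aff {n : ℕ} (x : (nerve P) _⦋n⦌) : C(stdSimplex ℝ (Fin (n + 1)), K P) :=
  ⟨fun t => ⟨stdSimplex.map x.obj t, chain_map (X := Fin (n+1)) _ x.monotone _
      (fun a _ b _ _ => le_total a b)⟩,
    Continuous.subtype_mk (stdSimplex.continuous_map _) _⟩

lemma aff_map {n m : ℕ} (θ : (⦋n⦌ : SimplexCategory) ⟶ ⦋m⦌) (x : (nerve P) _⦋m⦌)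
    (t : stdSimplex ℝ (Fin (n + 1))) :
    aff ((nerve P).map θ.op x) t = aff x (stdSimplex.map θ t) :=
  Subtype.ext (stdSimplex.map_comp_apply (X := Fin (n + 1)) (Y := Fin (m + 1)) θ x.obj t).symm

variable (P) in
noncomputable def affS : nerve P ⟶ TopCat.toSSet.obj (TopCat.of (K P)) where
  app n := ↾fun x => (TopCat.toSSetObjEquiv (TopCat.of (K P)) n).symm (aff (n := n.unop.len) x)
  naturality := by
    rintro ⟨⟨m⟩⟩ ⟨⟨n⟩⟩ ⟨θ⟩
    ext x
    apply (TopCat.toSSetObjEquiv (TopCat.of (K P)) (op ⦋n⦌)).injective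
    ext1 t
    exact aff_map θ x t

variable (P) in
noncomputable def bary : SSet.toTop.obj (nerve P) ⟶ TopCat.of (K P) :=
  (sSetTopAdj.homEquiv _ _).symm (affS P)

lemma bary_phi {n : ℕ} (x : (nerve P) _⦋n⦌) (t) : bary P (phi _ x t) = aff x t := by
  have := homEquiv_phi (bary P) x t
  rw [← this]
  unfold bary
  rw [Equiv.apply_symm_apply]
  rfl

lemma bary_inj : Function.Injective (bary P) := by
  intro z z' h
  obtain ⟨n, x, t, rfl⟩ := phi_surj z
  obtain ⟨n', x', t', rfl⟩ := phi_surj z'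
  obtain ⟨m, y, u, hy, hu, e⟩ := canonical n x t
  obtain ⟨m', y', u', hy', hu', e'⟩ := canonical n' x' t'
  rw [← e, ← e'] at h ⊢
  rw [bary_phi, bary_phi] at h
  have hw : stdSimplex.map y.obj u = stdSimplex.map y'.obj u' := congrArg Subtype.val h
  have hr : Set.range y.obj = Set.range y'.obj := by
    have h1 : ∀ {m : ℕ} (y : (nerve P) _⦋m⦌) (u : stdSimplex ℝ (Fin (m + 1))), (∀ i, u i ≠ 0) →
        Set.range y.obj = {p | stdSimplex.map (X := Fin (m+1)) y.obj u p ≠ 0} := by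
      intro m y u hu
      ext p
      rw [Set.mem_ofPred_eq, map_ne_zero]
      exact ⟨fun ⟨i, hi⟩ => ⟨i, hi, hu i⟩, fun ⟨i, hi, _⟩ => ⟨i, hi⟩⟩
    rw [h1 y u hu, h1 y' u' hu', hw]
  have hm : m = m' := by
    have h1 : Nat.card (Set.range y.obj) = m + 1 := by
      rw [Nat.card_range_of_injective hy.injective]; exact Nat.card_fin _
    have h2 : Nat.card (Set.range y'.obj) = m' + 1 := by
      rw [Nat.card_range_of_injective hy'.injective]; exact Nat.card_fin _
    rw [hr] at h1
    omega
  subst hm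
  have hyy : y = y' := by
    apply nerve.ext_of_isThin
    exact (StrictMono.range_inj (β := Fin (m+1)) hy hy').1 hr
  subst hyy
  have : u = u' := by
    ext i
    rw [← map_inj_apply (X := Fin (m+1)) y.obj hy.injective u i, hw]
    exact map_inj_apply (X := Fin (m+1)) y.obj hy.injective u' i
  rw [this]

lemma exists_chain (s : Set P) (hs : IsChain (· ≤ ·) s) (hne : s.Nonempty) :
    ∃ (m : ℕ) (x : Fin (m + 1) → P), StrictMono x ∧ Set.range x = s := by
  classical
  let : LinearOrder s := IsChain.linearOrder hs
  have : Nonempty s := hne.to_subtype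
  obtain ⟨m, hm⟩ : ∃ m, Fintype.card s = m + 1 := ⟨_, (Nat.succ_pred Fintype.card_ne_zero).symm⟩
  let e : Fin (m + 1) ≃o s := Fintype.orderIsoFinOfCardEq s hm
  refine ⟨m, fun i => (e i : P), fun i j h => ?_, ?_⟩
  · exact e.strictMono h
  · ext p
    constructor
    · rintro ⟨i, rfl⟩; exact (e i).2
    · intro hp; exact ⟨e.symm ⟨p, hp⟩, by simp⟩

lemma bary_surj : Function.Surjective (bary P) := by
  classical
  intro w
  change K P at w
  have hsum : ∑ p, w.1 p = 1 := stdSimplex.sum_eq_one w.1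
  obtain ⟨m, x, hx, hr⟩ := exists_chain {p | w.1 p ≠ 0} w.2 (by
    by_contra h
    rw [Set.not_nonempty_iff_eq_empty, Set.eq_empty_iff_forall_notMem] at h
    rw [Finset.sum_eq_zero (fun p _ => by simpa using h p)] at hsum
    exact zero_ne_one hsum)
  have hr' : ∀ p, w.1 p ≠ 0 ↔ ∃ i, x i = p := fun p => by
    have := Set.ext_iff.1 hr p
    exact this.symm
  have hz : ∀ p, p ∉ Set.range x → w.1 p = 0 := fun p hp => by
    by_contra h
    exact hp ((hr' p).1 h)
  have hs : ∑ i, w.1 (x i) = 1 := by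
    rw [← hsum]
    exact Fintype.sum_of_injective x hx.injective _ _ hz (fun _ => rfl)
  let t : stdSimplex ℝ (Fin (m + 1)) := ⟨fun i => w.1 (x i), fun i => stdSimplex.zero_le _ _, hs⟩
  refine ⟨phi (nerve P) (n := m) hx.monotone.functor t, ?_⟩
  refine (bary_phi (n := m) hx.monotone.functor t).trans ?_
  apply Subtype.ext
  change stdSimplex.map x t = w.1
  ext p
  by_cases hp : ∃ i, x i = p
  · obtain ⟨i, rfl⟩ := hp
    rw [map_inj_apply x hx.injective]; rfl
  · rw [hz p hp]
    by_contra h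
    obtain ⟨i, hi, _⟩ := (map_ne_zero _ _ _).1 h
    exact hp ⟨i, hi⟩

instance : CompactSpace (SSet.toTop.obj (nerve P)) := by
  classical
  have hfin : ∀ n, Finite ((nerve P) _⦋n⦌) := fun n =>
    Finite.of_injective (fun x => (x.obj : Fin (n+1) → P)) (fun x y h => nerve.ext_of_isThin h)
  have : (Set.univ : Set (SSet.toTop.obj (nerve P))) =
      ⋃ (n : Fin (Fintype.card P)), ⋃ (x : (nerve P) _⦋n.1⦌), Set.range (phi (nerve P) x) := by
    symm
    rw [Set.eq_univ_iff_forall]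
    intro z
    obtain ⟨n, x, t, rfl⟩ := phi_surj z
    obtain ⟨m, y, u, hy, hu, e⟩ := canonical n x t
    have hm := Fintype.card_le_of_injective (α := Fin (m+1)) y.obj hy.injective
    rw [Fintype.card_fin] at hm
    simp only [Set.mem_iUnion]
    exact ⟨⟨m, hm⟩, y, u, e⟩
  refine ⟨?_⟩
  rw [this]
  refine isCompact_iUnion fun n => ?_
  have := hfin n
  refine isCompact_iUnion fun x => ?_
  exact isCompact_range (phi (nerve P) x).continuous

variable (P) in
noncomputable def homeo : SSet.toTop.obj (nerve P) ≃ₜ K P :=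
  Continuous.homeoOfEquivCompactToT2 (f := Equiv.ofBijective (bary P) ⟨bary_inj, bary_surj⟩)
    (bary P).hom.continuous

/-- mass strictly below `p` -/
noncomputable def L (w : stdSimplex ℝ P) (p : P) : ℝ := by
  classical exact ∑ q with q < p, w q

/-- part of the mass of `w` at `p` among the lowest `c` -/
noncomputable def low (c : ℝ) (w : stdSimplex ℝ P) (p : P) : ℝ :=
  min (L w p + w p) c - min (L w p) c

lemma L_nonneg (w : stdSimplex ℝ P) (p : P) : 0 ≤ L w p := by
  unfold L
  exact Finset.sum_nonneg (fun i _ => stdSimplex.zero_le w i)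

lemma L_add_le_one (w : stdSimplex ℝ P) (p : P) : L w p + w p ≤ 1 := by
  classical
  have : L w p + w p = ∑ q ∈ insert p (Finset.univ.filter (· < p)), w q := by
    rw [Finset.sum_insert (by simp), add_comm]; unfold L; congr
  rw [this, ← stdSimplex.sum_eq_one w]
  exact Finset.sum_le_sum_of_subset_of_nonneg (Finset.subset_univ _)
    (fun i _ _ => stdSimplex.zero_le w i)

lemma L_add_le (w : stdSimplex ℝ P) {q p : P} (h : q < p) : L w q + w q ≤ L w p := by
  classical
  have : L w q + w q = ∑ r ∈ insert q (Finset.univ.filter (· < q)), w r := by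
    rw [Finset.sum_insert (by simp), add_comm]; unfold L; congr
  rw [this]
  unfold L
  refine (Finset.sum_le_sum_of_subset_of_nonneg (t := Finset.univ.filter (· < p)) ?_
    (fun i _ _ => stdSimplex.zero_le w i)).trans (le_of_eq (by congr))
  intro r hr
  simp only [Finset.mem_insert, Finset.mem_filter, Finset.mem_univ, true_and] at hr ⊢
  rcases hr with rfl | hr
  · exact h
  · exact hr.trans h

lemma low_nonneg (c : ℝ) (w : stdSimplex ℝ P) (p : P) : 0 ≤ low c w p := by
  have := stdSimplex.zero_le w p
  unfold low; grind

lemma low_le (c : ℝ) (w : stdSimplex ℝ P) (p : P) : low c w p ≤ w p := by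
  have := stdSimplex.zero_le w p
  unfold low; grind

lemma low_ne {c : ℝ} {w : stdSimplex ℝ P} {p : P} (h : low c w p ≠ 0) : w p ≠ 0 ∧ L w p < c := by
  have := stdSimplex.zero_le w p
  unfold low at h; grind

lemma sub_low_ne {c : ℝ} {w : stdSimplex ℝ P} {p : P} (h : w p - low c w p ≠ 0) :
    w p ≠ 0 ∧ c < L w p + w p := by
  have := stdSimplex.zero_le w p
  unfold low at h; grind

lemma low_zero (w : stdSimplex ℝ P) (p : P) : low 0 w p = 0 := by
  have := stdSimplex.zero_le w p
  have := L_nonneg w p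
  unfold low; grind

lemma low_one (w : stdSimplex ℝ P) (p : P) : low 1 w p = w p := by
  have := stdSimplex.zero_le w p
  have := L_add_le_one w p
  unfold low; grind

open Classical in
/-- The homotopy, on underlying functions. -/
noncomputable def G (f : P → P) (c : ℝ) (w : stdSimplex ℝ P) (p : P) : ℝ :=
  low c w p + ∑ q with f q = p, (w q - low c w q)

lemma G_mem (f : P → P) (c : ℝ) (w : stdSimplex ℝ P) : G f c w ∈ stdSimplex ℝ P := by
  classical
  refine ⟨fun p => ?_, ?_⟩
  · exact add_nonneg (low_nonneg _ _ _)
      (Finset.sum_nonneg fun q _ => sub_nonneg.2 (low_le _ _ _))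
  · unfold G
    have h := Finset.sum_fiberwise Finset.univ f (fun q => w q - low c w q)
    rw [Finset.sum_add_distrib]
    have h2 : ∑ x, ∑ q with f q = x, (w q - low c w q) = ∑ q, (w q - low c w q) := by
      rw [← h]
    refine (congrArg (∑ x, low c w x + ·) (Eq.trans (by congr!) h2)).trans ?_
    rw [Finset.sum_sub_distrib,
      stdSimplex.sum_eq_one]
    ring

lemma G_ne {f : P → P} {c : ℝ} {w : stdSimplex ℝ P} {p : P} (h : G f c w p ≠ 0) :
    (w p ≠ 0 ∧ L w p < c) ∨ ∃ q, f q = p ∧ w q ≠ 0 ∧ c < L w q + w q := by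
  classical
  by_cases h1 : low c w p = 0
  · right
    unfold G at h
    rw [h1, zero_add] at h
    obtain ⟨q, hq, hq'⟩ := Finset.exists_ne_zero_of_sum_ne_zero h
    exact ⟨q, by simpa using hq, sub_low_ne hq'⟩
  · exact Or.inl (low_ne h1)

lemma G_chain (f : P → P) (hmono : Monotone f) (hinfl : ∀ x : P, x ≤ f x) (c : ℝ) (w : K P) :
    IsChain (· ≤ ·) {p | G f c w.1 p ≠ 0} := by
  have key : ∀ p q, w.1 p ≠ 0 → L w.1 p < c → w.1 q ≠ 0 → c < L w.1 q + w.1 q → p ≤ f q := by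
    intro p q hp hpc hq hqc
    have hpq : p ≤ q := by
      rcases w.2.total hp hq with h | h
      · exact h
      · rcases h.lt_or_eq with h | h
        · have := L_add_le w.1 h
          linarith
        · exact h.ge
    exact hpq.trans (hinfl q)
  intro a ha b hb _
  rcases G_ne ha with ⟨ha1, ha2⟩ | ⟨q, rfl, hq1, hq2⟩ <;>
  rcases G_ne hb with ⟨hb1, hb2⟩ | ⟨r, rfl, hr1, hr2⟩
  · exact w.2.total ha1 hb1
  · exact Or.inl (key _ _ ha1 ha2 hr1 hr2)
  · exact Or.inr (key _ _ hb1 hb2 hq1 hq2)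
  · rcases w.2.total hq1 hr1 with h | h
    · exact Or.inl (hmono h)
    · exact Or.inr (hmono h)

lemma continuous_eval (p : P) : Continuous (fun x : ℝ × K P => x.2.1 p) :=
  (continuous_apply p).comp (continuous_subtype_val.comp
    (continuous_subtype_val.comp continuous_snd))

lemma continuous_low (p : P) : Continuous (fun x : ℝ × K P => low x.1 x.2.1 p) := by
  have hL : Continuous (fun x : ℝ × K P => L x.2.1 p) :=
    continuous_finsetSum _ (fun q _ => continuous_eval q)
  exact ((hL.add (continuous_eval p)).min continuous_fst).sub (hL.min continuous_fst)

lemma continuous_G (f : P → P) (hmono : Monotone f) (hinfl : ∀ x : P, x ≤ f x) :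
    Continuous (fun x : ℝ × K P =>
      (⟨⟨G f x.1 x.2.1, G_mem f x.1 x.2.1⟩, G_chain f hmono hinfl x.1 x.2⟩ : K P)) := by
  refine Continuous.subtype_mk (Continuous.subtype_mk (continuous_pi fun p => ?_) _) _
  exact (continuous_low p).add
    (continuous_finsetSum _ fun q _ => (continuous_eval q).sub (continuous_low q))

lemma push_homotopic (f : P → P) (hmono : Monotone f) (hinfl : ∀ x : P, x ≤ f x) :
    (push f hmono).Homotopic (ContinuousMap.id (K P)) := by
  classical
  refine ⟨⟨⟨fun x => ⟨⟨G f x.1 x.2.1, G_mem f x.1 x.2.1⟩, G_chain f hmono hinfl x.1 x.2⟩,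
    (continuous_G f hmono hinfl).comp
      ((continuous_subtype_val.comp continuous_fst).prodMk continuous_snd)⟩, ?_, ?_⟩⟩
  · intro w
    apply Subtype.ext
    ext p
    change G f 0 w.1 p = stdSimplex.map f w.1 p
    rw [map_apply]
    simp only [G, low_zero, sub_zero, zero_add]
  · intro w
    apply Subtype.ext
    ext p
    change G f 1 w.1 p = w.1 p
    simp [G, low_one]

end
end OC

/-- If `P` is a finite poset and `f : P → P` is order-preserving,
inflationary (`x ≤ f x`) and idempotent, then the order complex of `P` is homotopy
equivalent to the order complex of the image `f(P)`. -/
theorem stmt_8 {P : Type} [PartialOrder P] [Fintype P] (f : P → P)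
    (hmono : Monotone f) (hinfl : ∀ x : P, x ≤ f x)
    (hidem : ∀ x : P, f (f x) = f x) :
    Nonempty (ContinuousMap.HomotopyEquiv
      (orderComplexSpace P)
      (orderComplexSpace {y : P // y ∈ Set.range f})) := by
  classical
  let r : P → {y : P // y ∈ Set.range f} := fun x => ⟨f x, x, rfl⟩
  have hr : Monotone r := fun x y h => hmono h
  have hi : Monotone (Subtype.val : {y : P // y ∈ Set.range f} → P) := fun x y h => h
  have hri : r ∘ Subtype.val = id := by
    funext ⟨y, x, hx⟩
    apply Subtype.ext
    change f y = y
    rw [← hx, hidem]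
  let e : ContinuousMap.HomotopyEquiv (OC.K P) (OC.K {y : P // y ∈ Set.range f}) :=
    { toFun := OC.push r hr
      invFun := OC.push Subtype.val hi
      left_inv := by
        have : (OC.push Subtype.val hi).comp (OC.push r hr) = OC.push f hmono := by
          ext1 w
          exact Subtype.ext (stdSimplex.map_comp_apply _ _ _)
        rw [this]
        exact OC.push_homotopic f hmono hinfl
      right_inv := by
        have : (OC.push r hr).comp (OC.push Subtype.val hi) = ContinuousMap.id _ := by
          ext1 w
          apply Subtype.ext
          refine (stdSimplex.map_comp_apply _ _ _).trans ?_
          change stdSimplex.map (r ∘ Subtype.val) w.1 = w.1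
          rw [hri, stdSimplex.map_id_apply]
        rw [this] }
  exact ⟨((OC.homeo P).toHomotopyEquiv.trans e).trans
    (OC.homeo {y : P // y ∈ Set.range f}).symm.toHomotopyEquiv⟩
end

section
/- Let X be a finite rack such that every maximal proper subrack is stabilized by Inn(X) and the proper subrack poset is nonempty. Then the poset Inf(R(X)) of nonempty proper subracks that are intersections of maximal proper subracks is isomorphic to the proper part of the Boolean lattice on m elements, where m is the number of Inn(X)-orbits in X. Consequently, the order complex of the poset of nonempty proper subracks of X is homotopy equivalent to the sphere S^{m-2}. -/
open CategoryTheory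

/-- `S` is a subrack. -/
def IsSubrack10 {X : Type*} (op : X → X → X) (S : Set X) : Prop :=
  ∀ a ∈ S, Set.BijOn (op a) S S

/-- `M` is a maximal proper subrack of `X`. -/
def IsMaxProperSubrack10 {X : Type*} (op : X → X → X) (M : Set X) : Prop :=
  IsSubrack10 op M ∧ M ≠ Set.univ ∧
    ∀ S : Set X, IsSubrack10 op S → M ⊂ S → S = Set.univ

/-- The inner automorphism group of the rack `(X, op)`. -/
def InnRack10 {X : Type*} (op : X → X → X) (hbij : ∀ a : X, Function.Bijective (op a)) :
    Subgroup (Equiv.Perm X) :=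
  Subgroup.closure (Set.range fun a => Equiv.ofBijective (op a) (hbij a))

/-- Geometric realization of the order complex of a poset (nerve of the poset
category). -/
noncomputable def orderComplexSpace10 (P : Type) [PartialOrder P] : TopCat :=
  SSet.toTop.obj (nerve P)


open CategoryTheory Simplicial Opposite

namespace RackOrder

lemma map_apply {α β : Type} [Fintype α] [Fintype β] [DecidableEq β] (f : α → β)
    (s : stdSimplex ℝ α) (b : β) :
    stdSimplex.map f s b = ∑ a, if f a = b then s a else 0 := by
  rw [stdSimplex.map_coe, FunOnFinite.linearMap_apply_apply, Finset.sum_filter]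

lemma map_ne_zero {α β : Type} [Fintype α] [Fintype β] (f : α → β)
    (s : stdSimplex ℝ α) (b : β) (h : stdSimplex.map f s b ≠ 0) : ∃ a, f a = b ∧ s a ≠ 0 := by
  classical
  rw [map_apply] at h
  obtain ⟨a, -, ha⟩ := Finset.exists_ne_zero_of_sum_ne_zero h
  exact ⟨a, by by_contra hh; simp [hh] at ha, fun hh => by simp [hh] at ha⟩

lemma map_apply_ne_zero {α β : Type} [Fintype α] [Fintype β] (f : α → β)
    (s : stdSimplex ℝ α) (a : α) (h : s a ≠ 0) : stdSimplex.map f s (f a) ≠ 0 := by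
  classical
  rw [map_apply]
  have h0 : 0 < s a := lt_of_le_of_ne (stdSimplex.zero_le s a) (Ne.symm h)
  have : s a ≤ ∑ a', if f a' = f a then s a' else 0 := by
    have := Finset.single_le_sum (f := fun a' => if f a' = f a then s a' else 0)
      (s := Finset.univ) (fun i _ => by split_ifs <;> simp) (Finset.mem_univ a)
    simpa using this
  linarith

/-- Concrete order complex. -/
def K (P : Type) [PartialOrder P] [Fintype P] : Type :=
  {f : stdSimplex ℝ P // ∀ p q, f p ≠ 0 → f q ≠ 0 → p ≤ q ∨ q ≤ p}

instance (P : Type) [PartialOrder P] [Fintype P] : TopologicalSpace (K P) :=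
  inferInstanceAs (TopologicalSpace {f : stdSimplex ℝ P // _})

instance (P : Type) [PartialOrder P] [Fintype P] : T2Space (K P) :=
  inferInstanceAs (T2Space {f : stdSimplex ℝ P // _})

/-- The cell map. -/
noncomputable def cell (X : SSet.{0}) (n : SimplexCategory) (x : X.obj (op n))
    (t : stdSimplex ℝ (Fin (n.len + 1))) : SSet.toTop.obj X :=
  SSet.toTop.map (SSet.yonedaEquiv.symm x) (n.toTopHomeo.symm t)

lemma continuous_cell (X : SSet.{0}) (n : SimplexCategory) (x : X.obj (op n)) :
    Continuous (cell X n x) := by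
  unfold cell
  exact (SSet.toTop.map (SSet.yonedaEquiv.symm x)).hom.continuous.comp
    n.toTopHomeo.symm.continuous

lemma cell_map (X : SSet.{0}) {n m : SimplexCategory} (f : n ⟶ m) (x : X.obj (op m))
    (t : stdSimplex ℝ (Fin (n.len + 1))) :
    cell X n (X.map f.op x) t = cell X m x (stdSimplex.map f t) := by
  unfold cell
  rw [SimplexCategory.toTopHomeo_symm_naturality_apply]
  have : SSet.yonedaEquiv.symm (X.map f.op x) = SSet.stdSimplex.map f ≫ SSet.yonedaEquiv.symm x := by
    rw [SSet.yonedaEquiv_symm_naturality_left]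
  rw [this, Functor.map_comp]
  rfl

lemma hom_ext_cell (X : SSet.{0}) (Z : TopCat.{0}) (f g : SSet.toTop.obj X ⟶ Z)
    (h : ∀ n x t, f (cell X n x t) = g (cell X n x t)) : f = g := by
  apply (sSetTopAdj.homEquiv _ _).injective
  ext n x
  have key : ∀ f : SSet.toTop.obj X ⟶ Z, (sSetTopAdj.homEquiv X Z f).app n x =
      SSet.yonedaEquiv (sSetTopAdj.homEquiv _ _
        (SSet.toTop.map (SSet.yonedaEquiv.symm (show X.obj (op n.unop) from x)) ≫ f)) := by
    intro f
    rw [Adjunction.homEquiv_naturality_left, SSet.yonedaEquiv_symm_comp, Equiv.apply_symm_apply]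
  refine (key f).trans (Eq.trans ?_ (key g).symm)
  congr 2
  ext y
  have := h n.unop x (n.unop.toTopHomeo y)
  simpa [cell] using this

lemma cell_surj (X : SSet.{0}) (z : SSet.toTop.obj X) : ∃ n x t, cell X n x t = z := by
  let Z : TopCat.{0} := @TopCat.of Prop ⊤
  let f : SSet.toTop.obj X ⟶ Z := @TopCat.ofHom _ _ _ ⊤
    (@ContinuousMap.mk _ _ _ ⊤ (fun z => ∃ n x t, cell X n x t = z) continuous_top)
  let g : SSet.toTop.obj X ⟶ Z := @TopCat.ofHom _ _ _ ⊤
    (@ContinuousMap.mk _ _ _ ⊤ (fun z => True) continuous_top)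
  have : f = g := hom_ext_cell X Z f g (by
    intro n x t
    show (∃ n' x' t', cell X n' x' t' = cell X n x t) = True
    exact eq_true ⟨n, x, t, rfl⟩)
  have h2 : f z = g z := by rw [this]
  exact of_eq_true h2

variable (P : Type) [PartialOrder P] [Fintype P]

lemma toK_chain (n : ℕ) (x : ComposableArrows P n) (t : stdSimplex ℝ (Fin (n + 1))) (p q : P)
    (hp : stdSimplex.map x.obj t p ≠ 0) (hq : stdSimplex.map x.obj t q ≠ 0) : p ≤ q ∨ q ≤ p := by
  obtain ⟨i, hi, -⟩ := map_ne_zero _ _ _ hp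
  obtain ⟨j, hj, -⟩ := map_ne_zero _ _ _ hq
  rw [← hi, ← hj]
  rcases le_total i j with h | h
  · exact Or.inl (leOfHom (x.map (homOfLE h)))
  · exact Or.inr (leOfHom (x.map (homOfLE h)))

/-- Map on simplices. -/
noncomputable def toK (n : ℕ) (x : ComposableArrows P n) :
    C(stdSimplex ℝ (Fin (n + 1)), K P) where
  toFun t := ⟨stdSimplex.map x.obj t, toK_chain P n x t⟩
  continuous_toFun := (stdSimplex.continuous_map _).subtype_mk _

lemma toK_map {n m : SimplexCategory} (f : n ⟶ m) (x : (nerve P).obj (op m)) :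
    toK P n.len ((nerve P).map f.op x) =
      (toK P m.len x).comp ⟨stdSimplex.map f, stdSimplex.continuous_map _⟩ := by
  apply ContinuousMap.ext
  intro t
  apply Subtype.ext
  have h := stdSimplex.map_comp_apply (S := ℝ) (X := Fin (n.len + 1)) (Y := Fin (m.len + 1)) (Z := P)
    (fun i => f i) (fun i => Functor.obj (C := Fin (m.len + 1)) (D := P) x i) t
  exact h.symm

noncomputable def nerveToSingApp (n : SimplexCategoryᵒᵖ) (x : (nerve P).obj n) :
    (TopCat.toSSet.obj (TopCat.of (K P))).obj n :=
  (TopCat.toSSetObjEquiv (TopCat.of (K P)) n).symm (toK P n.unop.len x)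

lemma nerveToSingApp_map {n m : SimplexCategory} (f : n ⟶ m) (x : (nerve P).obj (op m)) :
    nerveToSingApp P (op n) ((nerve P).map f.op x) =
      (TopCat.toSSet.obj (TopCat.of (K P))).map f.op (nerveToSingApp P (op m) x) := by
  unfold nerveToSingApp
  rw [TopCat.toSSetObjEquiv_symm_naturality]
  exact congrArg _ (toK_map P f x)

noncomputable def nerveToSing : nerve P ⟶ TopCat.toSSet.obj (TopCat.of (K P)) where
  app n := ↾(nerveToSingApp P n)
  naturality n m f := by
    ext x
    exact nerveToSingApp_map P f.unop x

noncomputable def realToK : SSet.toTop.obj (nerve P) ⟶ TopCat.of (K P) :=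
  (sSetTopAdj.homEquiv _ _).symm (nerveToSing P)

lemma realToK_cell (n : SimplexCategory) (x : (nerve P).obj (op n)) (t) :
    realToK P (cell _ n x t) = toK P n.len x t := by
  have h : sSetTopAdj.unit.app _ ≫ TopCat.toSSet.map (realToK P) = nerveToSing P := by
    exact (Adjunction.homEquiv_unit _ _ _ _).symm.trans (Equiv.apply_symm_apply _ _)
  have h2 := congrArg (fun F => (F.app (op n) x).down) h
  have h3 := ConcreteCategory.congr_hom h2 (ULift.up t)
  have h4 := congrArg (fun (G : SimplexCategory.toTop.{0}.obj n ⟶ SSet.toTop.obj (nerve P)) => (realToK P) (G (ULift.up t)))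
    (sSetTopAdj_unit_app_app_down (nerve P) (op n) x)
  exact h4.symm.trans h3
end RackOrder
namespace RackOrder
variable (P : Type) [PartialOrder P] [Fintype P]

lemma exists_enum (f : K P) : ∃ (k : ℕ) (c : Fin (k + 1) → P), StrictMono c ∧
    Set.range c = {p | f.1 p ≠ 0} := by
  classical
  have hch : IsChain (· ≤ ·) {p | f.1 p ≠ 0} := by
    intro p hp q hq _
    exact f.2 p q hp hq
  let _ := hch.linearOrder
  have hne : Nonempty {p // f.1 p ≠ 0} := by
    by_contra hh
    have h0 : ∀ p, f.1 p = 0 := fun p => by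
      by_contra hp
      exact hh ⟨p, hp⟩
    have := stdSimplex.sum_eq_one f.1
    simp [h0] at this
  have hc : Fintype.card {p // f.1 p ≠ 0} = (Fintype.card {p // f.1 p ≠ 0} - 1) + 1 := by
    have := Fintype.card_pos_iff.2 hne
    omega
  let e := Fintype.orderIsoFinOfCardEq {p // p ∈ {p | f.1 p ≠ 0}} hc
  refine ⟨_, fun i => (e i).1, fun i j hij => ?_, ?_⟩
  · exact e.strictMono hij
  · ext p
    constructor
    · rintro ⟨i, rfl⟩
      exact (e i).2
    · intro hp
      exact ⟨e.symm ⟨p, hp⟩, by simp⟩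

lemma map_injective_of_injective {α β : Type} [Fintype α] [Fintype β] (c : α → β)
    (hc : Function.Injective c) (s : stdSimplex ℝ α) (a : α) :
    stdSimplex.map c s (c a) = s a := by
  classical
  rw [map_apply]
  simp [hc.eq_iff]

lemma mapid_of_supp {α : Type} [Fintype α] (c : α → α) (s : stdSimplex ℝ α)
    (h : ∀ a, s a ≠ 0 → c a = a) : stdSimplex.map c s = s := by
  classical
  apply stdSimplex.ext
  ext b
  rw [map_apply]
  have : ∀ a, (if c a = b then s a else 0) = if a = b then s a else 0 := by
    intro a
    by_cases ha : s a = 0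
    · simp [ha]
    · rw [h a ha]
  simp [this]

/-- face deletion -/
lemma exists_pos_cell (n : ℕ) (x : ComposableArrows P n) (t : stdSimplex ℝ (Fin (n + 1))) :
    ∃ (l : ℕ) (y : ComposableArrows P l) (t' : stdSimplex ℝ (Fin (l + 1))),
      (∀ i, t' i ≠ 0) ∧ cell (nerve P) ⦋l⦌ y t' = cell (nerve P) ⦋n⦌ x t := by
  classical
  let S : Finset (Fin (n + 1)) := Finset.univ.filter (fun i => t i ≠ 0)
  have hsum : ∑ i ∈ S, t i = 1 := by
    rw [← stdSimplex.sum_eq_one t, Finset.sum_filter_ne_zero]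
  have hpos : 0 < S.card := by
    rw [Finset.card_pos]
    by_contra hh
    rw [Finset.not_nonempty_iff_eq_empty] at hh
    simp [hh] at hsum
  have hcard : S.card = (S.card - 1) + 1 := by omega
  let ι := S.orderEmbOfFin hcard
  have hι : Finset.image ι Finset.univ = S := by simp [ι]
  have hnz : ∀ i, t (ι i) ≠ 0 := fun i => by
    have := S.orderEmbOfFin_mem hcard i
    exact (Finset.mem_filter.1 this).2
  let t' : stdSimplex ℝ (Fin ((S.card - 1) + 1)) := ⟨fun i => t (ι i), fun i => by simp, by
    rw [← hsum]
    have h := Finset.sum_image (f := fun i => t i) (s := Finset.univ) (g := ι)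
      (fun a _ b _ h => ι.injective h)
    rw [hι] at h
    exact h.symm⟩
  let φ : ⦋S.card - 1⦌ ⟶ ⦋n⦌ := SimplexCategory.mkHom ι.toOrderHom
  refine ⟨S.card - 1, (nerve P).map φ.op x, t', fun i => hnz i, ?_⟩
  refine (cell_map (nerve P) φ x t').trans (congrArg (cell (nerve P) ⦋n⦌ x) ?_)
  apply stdSimplex.ext
  ext j
  by_cases hj : t j = 0
  · rw [hj]
    by_contra hh
    obtain ⟨a, ha, -⟩ := map_ne_zero _ _ _ hh
    have ha' : ι a = j := ha
    exact hnz a (by rw [ha', hj])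
  · have : j ∈ Set.range ι := by
      rw [Finset.range_orderEmbOfFin]; simp [S, hj]
    obtain ⟨a, rfl⟩ := this
    exact map_injective_of_injective ι ι.injective t' a

lemma cell_canonical (n : ℕ) (x : ComposableArrows P n) (t : stdSimplex ℝ (Fin (n + 1)))
    (k : ℕ) (c : Fin (k + 1) → P) (hc : StrictMono c)
    (hr : Set.range c = {p | (toK P n x t).1 p ≠ 0}) :
    ∃ s, cell (nerve P) ⦋k⦌ (hc.monotone.functor : ComposableArrows P k) s =
      cell (nerve P) ⦋n⦌ x t := by
  obtain ⟨l, y, t', ht', h⟩ := exists_pos_cell P n x t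
  have hr' : ∀ i, y.obj i ∈ Set.range c := by
    intro i
    have e1 := realToK_cell P ⦋l⦌ y t'
    rw [h, realToK_cell P ⦋n⦌ x t] at e1
    have e1' : toK P n x t = toK P l y t' := e1
    rw [hr, e1']
    exact map_apply_ne_zero _ _ _ (ht' i)
  choose g hg using hr'
  have hmono : Monotone g := by
    intro i j hij
    have h1 : y.obj i ≤ y.obj j := leOfHom (y.map (homOfLE hij))
    rw [← hg, ← hg] at h1
    by_contra hh
    exact absurd (hc (not_le.1 hh)) (not_lt_of_ge h1)
  let φ : ⦋l⦌ ⟶ ⦋k⦌ := SimplexCategory.mkHom ⟨g, hmono⟩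
  refine ⟨stdSimplex.map g t', ?_⟩
  rw [← h]
  have : y = (nerve P).map φ.op (hc.monotone.functor : ComposableArrows P k) := by
    apply nerve.ext_of_isThin (n := op ⦋l⦌)
    funext i
    exact (hg i).symm
  rw [this]
  exact (cell_map (nerve P) φ _ t').symm

lemma realToK_injective : Function.Injective (realToK P) := by
  intro z z' hzz
  obtain ⟨n, x, t, rfl⟩ := cell_surj _ z
  obtain ⟨n', x', t', rfl⟩ := cell_surj _ z'
  rw [realToK_cell, realToK_cell] at hzz
  obtain ⟨k, c, hc, hr⟩ := exists_enum P (toK P n.len x t)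
  obtain ⟨s, hs⟩ := cell_canonical P n.len x t k c hc hr
  obtain ⟨s', hs'⟩ := cell_canonical P n'.len x' t' k c hc (by rw [hr, hzz])
  have hs1 : cell (nerve P) ⦋k⦌ (hc.monotone.functor : ComposableArrows P k) s = cell _ n x t := hs
  have hs2 : cell (nerve P) ⦋k⦌ (hc.monotone.functor : ComposableArrows P k) s' =
    cell _ n' x' t' := hs'
  have h1 := realToK_cell P ⦋k⦌ (hc.monotone.functor : ComposableArrows P k) s
  have h2 := realToK_cell P ⦋k⦌ (hc.monotone.functor : ComposableArrows P k) s'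
  rw [hs1, realToK_cell] at h1
  rw [hs2, realToK_cell] at h2
  have h3 : toK P k (hc.monotone.functor : ComposableArrows P k) s =
    toK P k (hc.monotone.functor : ComposableArrows P k) s' := h1.symm.trans (hzz.trans h2)
  have : s = s' := by
    apply stdSimplex.ext
    ext i
    have e1 := map_injective_of_injective c hc.injective s i
    have e2 := map_injective_of_injective c hc.injective s' i
    have e3 : stdSimplex.map c s = stdSimplex.map c s' := congrArg Subtype.val h3
    rw [← e1, ← e2, e3]
  rw [← hs1, ← hs2, this]

lemma realToK_surjective : Function.Surjective (realToK P) := by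
  classical
  intro f
  obtain ⟨k, c, hc, hr⟩ := exists_enum P f
  have hr' : ∀ p, p ∈ Set.range c ↔ f.1 p ≠ 0 := fun p => by rw [hr]; rfl
  let s : stdSimplex ℝ (Fin (k + 1)) := ⟨fun i => f.1 (c i), fun i => by simp, by
    rw [← stdSimplex.sum_eq_one f.1, ← Finset.sum_image (g := c) (f := fun p => f.1 p)
      (fun a _ b _ h => hc.injective h)]
    apply Finset.sum_subset (Finset.subset_univ _)
    intro p _ hp
    by_contra h
    obtain ⟨i, rfl⟩ := (hr' p).2 h
    simp at hp⟩
  refine ⟨cell (nerve P) ⦋k⦌ (hc.monotone.functor : ComposableArrows P k) s, ?_⟩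
  refine (realToK_cell P ⦋k⦌ _ s).trans ?_
  apply Subtype.ext
  apply stdSimplex.ext
  ext p
  by_cases hp : f.1 p = 0
  · rw [hp]
    by_contra hh
    obtain ⟨a, ha, -⟩ := map_ne_zero _ _ _ hh
    have ha' : c a = p := ha
    exact (hr' p).1 ⟨a, ha'⟩ hp
  · obtain ⟨i, rfl⟩ := (hr' p).2 hp
    exact map_injective_of_injective c hc.injective s i

lemma compact_real : CompactSpace (SSet.toTop.obj (nerve P)) := by
  constructor
  have hfin : ∀ k : ℕ, Finite (ComposableArrows P k) := fun k =>
    Finite.of_injective (fun x : ComposableArrows P k => (x.obj : Fin (k + 1) → P))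
      (fun x y h => nerve.ext_of_isThin (n := op ⦋k⦌) h)
  have : (Set.univ : Set (SSet.toTop.obj (nerve P))) =
      ⋃ k : Fin (Fintype.card P), ⋃ x : ComposableArrows P k.1,
        Set.range (cell (nerve P) ⦋k.1⦌ x) := by
    symm
    rw [Set.eq_univ_iff_forall]
    intro z
    obtain ⟨n, x, t, rfl⟩ := cell_surj _ z
    obtain ⟨k, c, hc, hr⟩ := exists_enum P (toK P n.len x t)
    obtain ⟨s, hs⟩ := cell_canonical P n.len x t k c hc hr
    have hk : k < Fintype.card P := by
      have := Fintype.card_le_of_injective c hc.injective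
      simp at this
      omega
    simp only [Set.mem_iUnion]
    exact ⟨⟨k, hk⟩, hc.monotone.functor, s, hs⟩
  rw [this]
  refine isCompact_iUnion fun k => ?_
  have := hfin k.1
  exact isCompact_iUnion fun x => isCompact_range (continuous_cell _ _ _)

noncomputable def realHomeo : SSet.toTop.obj (nerve P) ≃ₜ K P :=
  haveI := compact_real P
  Continuous.homeoOfEquivCompactToT2
    (f := Equiv.ofBijective (realToK P) ⟨realToK_injective P, realToK_surjective P⟩)
    (realToK P).hom.continuous
end RackOrder
namespace RackOrder
section
variable {P Q : Type} [PartialOrder P] [Fintype P] [PartialOrder Q] [Fintype Q]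

noncomputable def Kmap (c : P →o Q) : C(K P, K Q) where
  toFun f := ⟨stdSimplex.map c f.1, fun p q hp hq => by
    obtain ⟨a, rfl, ha⟩ := map_ne_zero _ _ _ hp
    obtain ⟨b, rfl, hb⟩ := map_ne_zero _ _ _ hq
    exact (f.2 a b ha hb).imp (fun h => c.monotone h) (fun h => c.monotone h)⟩
  continuous_toFun := ((stdSimplex.continuous_map _).comp continuous_subtype_val).subtype_mk _

open Classical in
noncomputable def wt (f : K P) (t : ℝ) (a : P) : ℝ :=
  min (f.1 a) (max 0 (t - ∑ b, if a < b then f.1 b else 0))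

lemma wt_nonneg (f : K P) (t : ℝ) (a : P) : 0 ≤ wt f t a :=
  le_min (by simp) (le_max_left _ _)

lemma wt_le (f : K P) (t : ℝ) (a : P) : wt f t a ≤ f.1 a := min_le_left _ _

open Classical in
noncomputable def hmt (u : P → P) (f : K P) (t : ℝ) (b : P) : ℝ :=
  f.1 b - wt f t b + ∑ a, if u a = b then wt f t a else 0

lemma hmt_mem (u : P → P) (f : K P) (t : ℝ) : hmt u f t ∈ stdSimplex ℝ P := by
  classical
  constructor
  · intro b
    have h1 := wt_le f t b
    have h2 : 0 ≤ ∑ a, if u a = b then wt f t a else 0 :=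
      Finset.sum_nonneg fun a _ => by split_ifs <;> simp [wt_nonneg]
    unfold hmt
    linarith
  · unfold hmt
    rw [Finset.sum_add_distrib, Finset.sum_sub_distrib, Finset.sum_comm]
    simp

lemma hmt_ne_zero (u : P → P) (f : K P) (t : ℝ) (b : P) (h : hmt u f t b ≠ 0) :
    (wt f t b < f.1 b) ∨ ∃ a, u a = b ∧ 0 < wt f t a := by
  classical
  by_contra! hh
  apply h
  unfold hmt
  have h1 : f.1 b = wt f t b := le_antisymm hh.1 (wt_le _ _ _)
  rw [h1, sub_self, zero_add]
  apply Finset.sum_eq_zero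
  intro a _
  split_ifs with hab
  · exact le_antisymm (hh.2 a hab) (wt_nonneg _ _ _)
  · rfl

lemma wt_order (f : K P) (t : ℝ) (a b : P) (ha : wt f t a < f.1 a) (hb : 0 < wt f t b) :
    a ≤ b := by
  classical
  have ha0 : f.1 a ≠ 0 := (lt_of_le_of_lt (wt_nonneg f t a) ha).ne'
  have hb0 : f.1 b ≠ 0 := (lt_of_lt_of_le hb (wt_le f t b)).ne'
  by_contra hab
  have hlt : b < a := lt_of_le_not_ge ((f.2 a b ha0 hb0).resolve_left hab) hab
  unfold wt at ha hb
  have h1 : t - (∑ c, if a < c then f.1 c else 0) < f.1 a := by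
    by_contra! h
    rw [min_eq_left (h.trans (le_max_right _ _))] at ha
    exact lt_irrefl _ ha
  have h2 : 0 < t - ∑ c, if b < c then f.1 c else 0 := by
    by_contra! h
    rw [max_eq_left h, min_eq_right (by simp)] at hb
    exact lt_irrefl _ hb
  have h3 : f.1 a + (∑ c, if a < c then f.1 c else 0) ≤ ∑ c, if b < c then f.1 c else 0 := by
    have : f.1 a = ∑ c, if a = c then f.1 c else 0 := by simp
    rw [this, ← Finset.sum_add_distrib]
    apply Finset.sum_le_sum
    intro c _
    have hc : 0 ≤ f.1 c := by simp
    by_cases h1 : a = c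
    · subst h1; simp [hlt]
    · by_cases h2 : a < c
      · simp [h1, h2, hlt.trans h2]
      · simp only [h1, h2, if_false]; split_ifs <;> simp
  linarith

lemma hmt_chain (u : P →o P) (hu : ∀ p, p ≤ u p) (f : K P) (t : ℝ) (p q : P)
    (hp : hmt u f t p ≠ 0) (hq : hmt u f t q ≠ 0) : p ≤ q ∨ q ≤ p := by
  rcases hmt_ne_zero _ _ _ _ hp with hp | ⟨a, rfl, ha⟩ <;>
  rcases hmt_ne_zero _ _ _ _ hq with hq | ⟨b, rfl, hb⟩
  · exact f.2 p q (lt_of_le_of_lt (wt_nonneg f t p) hp).ne'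
      (lt_of_le_of_lt (wt_nonneg f t q) hq).ne'
  · exact Or.inl ((wt_order f t p b hp hb).trans (hu b))
  · exact Or.inr ((wt_order f t q a hq ha).trans (hu a))
  · exact (f.2 a b (lt_of_lt_of_le ha (wt_le f t a)).ne'
      (lt_of_lt_of_le hb (wt_le f t b)).ne').imp (fun h => u.monotone h) (fun h => u.monotone h)

lemma continuous_eval (p : P) : Continuous (fun f : K P => f.1 p) :=
  (continuous_apply p).comp (continuous_subtype_val.comp continuous_subtype_val)

lemma continuous_wt (a : P) : Continuous (fun x : unitInterval × K P => wt x.2 x.1 a) := by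
  classical
  unfold wt
  have h := fun p => (continuous_eval (P := P) p).comp
    (continuous_snd (X := unitInterval) (Y := K P))
  refine (h a).min (continuous_const.max ((continuous_subtype_val.comp continuous_fst).sub
    (continuous_finsetSum _ fun b _ => ?_)))
  split_ifs
  · exact h b
  · exact continuous_const

lemma Kmap_homotopic (u : P →o P) (hu : ∀ p, p ≤ u p) :
    ContinuousMap.Homotopic (ContinuousMap.id (K P)) (Kmap u) := by
  classical
  refine ⟨{ toFun := fun x => ⟨⟨hmt u x.2 x.1, hmt_mem _ _ _⟩, hmt_chain u hu _ _⟩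
            continuous_toFun := ?_
            map_zero_left := ?_
            map_one_left := ?_ }⟩
  · refine Continuous.subtype_mk (Continuous.subtype_mk (continuous_pi fun b => ?_) _) _
    unfold hmt
    have h := fun p => (continuous_eval (P := P) p).comp
      (continuous_snd (X := unitInterval) (Y := K P))
    refine ((h b).sub (continuous_wt b)).add (continuous_finsetSum _ fun a _ => ?_)
    split_ifs
    · exact continuous_wt a
    · exact continuous_const
  · intro f
    have hw : ∀ a, wt f 0 a = 0 := fun a => by
      unfold wt
      rw [max_eq_left, min_eq_right (by simp)]
      have : 0 ≤ ∑ c, if a < c then f.1 c else 0 :=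
        Finset.sum_nonneg fun c _ => by split_ifs <;> simp
      linarith
    apply Subtype.ext
    apply Subtype.ext
    funext b
    show hmt u f ((0 : unitInterval) : ℝ) b = f.1 b
    simp [hmt, hw]
  · intro f
    have hw : ∀ a, wt f 1 a = f.1 a := fun a => by
      unfold wt
      apply min_eq_left
      refine le_trans ?_ (le_max_right _ _)
      have h1 := stdSimplex.sum_eq_one f.1
      have : f.1 a + (∑ c, if a < c then f.1 c else 0) ≤ ∑ c, f.1 c := by
        have : f.1 a = ∑ c, if a = c then f.1 c else 0 := by simp
        rw [this, ← Finset.sum_add_distrib]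
        apply Finset.sum_le_sum
        intro c _
        have hc : 0 ≤ f.1 c := by simp
        by_cases h1 : a = c
        · subst h1; simp
        · simp only [h1, if_false, zero_add]; split_ifs <;> simp
      linarith
    apply Subtype.ext
    apply Subtype.ext
    funext b
    show hmt u f ((1 : unitInterval) : ℝ) b = stdSimplex.map u f.1 b
    rw [map_apply]
    simp [hmt, hw]

noncomputable def Kequiv (c : P →o Q) (e : Q →o P) (hce : ∀ q, c (e q) = q)
    (hec : ∀ p, p ≤ e (c p)) : ContinuousMap.HomotopyEquiv (K P) (K Q) where
  toFun := Kmap c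
  invFun := Kmap e
  left_inv := by
    have : (Kmap e).comp (Kmap c) = Kmap (e.comp c) := by
      ext1 f
      apply Subtype.ext
      exact stdSimplex.map_comp_apply _ _ _
    rw [this]
    exact (Kmap_homotopic _ hec).symm
  right_inv := by
    have : (Kmap c).comp (Kmap e) = ContinuousMap.id _ := by
      ext1 f
      apply Subtype.ext
      refine (stdSimplex.map_comp_apply _ _ _).trans ?_
      have : (c : P → Q).comp e = id := funext hce
      rw [this]
      exact stdSimplex.map_id_apply _
    rw [this]
end
end RackOrder
namespace RackOrder
section
open MeasureTheory

lemma chain_max {P : Type} [PartialOrder P] [Fintype P] (f : K P) (p : P → Prop) :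
    (∀ B, f.1 B ≠ 0 → ¬ p B) ∨
      ∃ B, f.1 B ≠ 0 ∧ p B ∧ ∀ B', f.1 B' ≠ 0 → p B' → B' ≤ B := by
  classical
  by_cases h : ∃ B, f.1 B ≠ 0 ∧ p B
  · right
    have hn : (Finset.univ.filter fun B => f.1 B ≠ 0 ∧ p B).Nonempty := by
      obtain ⟨B, hB⟩ := h
      exact ⟨B, by simpa using hB⟩
    obtain ⟨B, hB⟩ := Finset.exists_maximal hn
    have hB1 := hB.1
    simp only [Finset.mem_filter, Finset.mem_univ, true_and] at hB1
    refine ⟨B, hB1.1, hB1.2, fun B' h1 h2 => ?_⟩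
    rcases f.2 B B' hB1.1 h1 with h | h
    · exact hB.2 (by simpa using ⟨h1, h2⟩) h
    · exact h
  · left
    intro B h1 h2
    exact h ⟨B, h1, h2⟩

lemma chain_min {P : Type} [PartialOrder P] [Fintype P] (f : K P) (p : P → Prop) :
    (∀ B, f.1 B ≠ 0 → ¬ p B) ∨
      ∃ B, f.1 B ≠ 0 ∧ p B ∧ ∀ B', f.1 B' ≠ 0 → p B' → B ≤ B' := by
  classical
  by_cases h : ∃ B, f.1 B ≠ 0 ∧ p B
  · right
    have hn : (Finset.univ.filter fun B => f.1 B ≠ 0 ∧ p B).Nonempty := by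
      obtain ⟨B, hB⟩ := h
      exact ⟨B, by simpa using hB⟩
    obtain ⟨B, hB⟩ := Finset.exists_minimal hn
    have hB1 := hB.1
    simp only [Finset.mem_filter, Finset.mem_univ, true_and] at hB1
    refine ⟨B, hB1.1, hB1.2, fun B' h1 h2 => ?_⟩
    rcases f.2 B B' hB1.1 h1 with h | h
    · exact h
    · exact hB.2 (by simpa using ⟨h1, h2⟩) h
  · left
    intro B h1 h2
    exact h ⟨B, h1, h2⟩

lemma exists_supp {P : Type} [PartialOrder P] [Fintype P] (f : K P) : ∃ p, f.1 p ≠ 0 := by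
  by_contra! hh
  have := stdSimplex.sum_eq_one f.1
  simp [hh] at this

/-- Proper part of the Boolean lattice. -/
abbrev BQ (O : Type) : Type := {A : Set O // A ≠ ∅ ∧ A ≠ Set.univ}

variable {O : Type} [Fintype O]

noncomputable instance : Fintype (BQ O) := Fintype.ofFinite _

def Y (O : Type) : Type :=
  {y : O → ℝ // (∀ i, 0 ≤ y i ∧ y i ≤ 1) ∧ (∃ i, y i = 0) ∧ ∃ i, y i = 1}

instance : TopologicalSpace (Y O) := inferInstanceAs (TopologicalSpace {y : O → ℝ // _})
instance : T2Space (Y O) := inferInstanceAs (T2Space {y : O → ℝ // _})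

open Classical in
noncomputable def gfun (f : K (BQ O)) (i : O) : ℝ := ∑ A : BQ O, if i ∈ A.1 then f.1 A else 0

lemma gfun_mem (f : K (BQ O)) : (∀ i, 0 ≤ gfun f i ∧ gfun f i ≤ 1) ∧
    (∃ i, gfun f i = 0) ∧ ∃ i, gfun f i = 1 := by
  classical
  obtain ⟨A₀, hA₀⟩ := exists_supp f
  refine ⟨fun i => ⟨Finset.sum_nonneg fun A _ => by split_ifs <;> simp, ?_⟩, ?_, ?_⟩
  · rw [← stdSimplex.sum_eq_one f.1]
    exact Finset.sum_le_sum fun A _ => by split_ifs <;> simp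
  · obtain h | ⟨B, hB, -, h⟩ := chain_max f (fun _ => True)
    · exact absurd trivial (h A₀ hA₀)
    · obtain ⟨i, hi⟩ := (Set.ne_univ_iff_exists_notMem _).1 B.2.2
      refine ⟨i, Finset.sum_eq_zero fun A _ => ?_⟩
      split_ifs with hiA
      · by_contra hA
        exact hi (h A hA trivial hiA)
      · rfl
  · obtain h | ⟨B, hB, -, h⟩ := chain_min f (fun _ => True)
    · exact absurd trivial (h A₀ hA₀)
    · obtain ⟨i, hi⟩ := Set.nonempty_iff_ne_empty.2 B.2.1
      refine ⟨i, ?_⟩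
      rw [← stdSimplex.sum_eq_one f.1]
      refine Finset.sum_congr rfl fun A _ => ?_
      split_ifs with hiA
      · rfl
      · by_contra hA
        exact hiA (h A (Ne.symm hA) trivial hi)

lemma gfun_sub (f : K (BQ O)) (i j : O) (A : BQ O)
    (h : ∀ B, B ≠ A → f.1 B ≠ 0 → i ∈ B.1 → j ∈ B.1) : gfun f i ≤ gfun f j + f.1 A := by
  classical
  have : f.1 A = ∑ B, if B = A then f.1 B else 0 := by simp
  unfold gfun
  rw [this, ← Finset.sum_add_distrib]
  refine Finset.sum_le_sum fun B _ => ?_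
  have h0 : 0 ≤ f.1 B := by simp
  by_cases hB : f.1 B = 0
  · simp [hB]
  · by_cases hBA : B = A
    · rw [if_pos hBA]
      split_ifs <;> simp
    · by_cases hi : i ∈ B.1
      · simp [hi, hBA, h B hBA hB hi]
      · simp only [hi, if_false]
        split_ifs <;> simp

lemma gfun_lower (f : K (BQ O)) (A : BQ O) :
    ∃ i j, i ∈ A.1 ∧ j ∉ A.1 ∧ gfun f i ≤ gfun f j + f.1 A := by
  by_cases hcomp : ∀ B, f.1 B ≠ 0 → B ≤ A ∨ A ≤ B
  · have h1 : ∃ i ∈ A.1, ∀ B, f.1 B ≠ 0 → B < A → i ∉ B.1 := by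
      obtain h | ⟨B, hB, hBA, h⟩ := chain_max f (fun B => B < A)
      · obtain ⟨i, hi⟩ := Set.nonempty_iff_ne_empty.2 A.2.1
        exact ⟨i, hi, fun B h1 h2 => absurd h2 (h B h1)⟩
      · obtain ⟨i, hi, hiB⟩ := Set.exists_of_ssubset (show B.1 ⊂ A.1 from hBA)
        exact ⟨i, hi, fun B' h1 h2 h3 => hiB (h B' h1 h2 h3)⟩
    have h2 : ∃ j, j ∉ A.1 ∧ ∀ B, f.1 B ≠ 0 → A < B → j ∈ B.1 := by
      obtain h | ⟨B, hB, hBA, h⟩ := chain_min f (fun B => A < B)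
      · obtain ⟨i, hi⟩ := (Set.ne_univ_iff_exists_notMem _).1 A.2.2
        exact ⟨i, hi, fun B h1 h2 => absurd h2 (h B h1)⟩
      · obtain ⟨i, hi, hiB⟩ := Set.exists_of_ssubset (show A.1 ⊂ B.1 from hBA)
        exact ⟨i, hiB, fun B' h1 h2 => h B' h1 h2 hi⟩
    obtain ⟨i, hi, hi'⟩ := h1
    obtain ⟨j, hj, hj'⟩ := h2
    refine ⟨i, j, hi, hj, gfun_sub f i j A fun B hBA hB hiB => ?_⟩
    rcases hcomp B hB with h | h
    · exact absurd hiB (hi' B hB (lt_of_le_of_ne h hBA))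
    · exact hj' B hB (lt_of_le_of_ne h (Ne.symm hBA))
  · push Not at hcomp
    obtain ⟨B, hB, h1, h2⟩ := hcomp
    obtain ⟨j, hjB, hjA⟩ := Set.not_subset.1 (show ¬ B.1 ⊆ A.1 from h1)
    obtain ⟨i, hiA, hiB⟩ := Set.not_subset.1 (show ¬ A.1 ⊆ B.1 from h2)
    refine ⟨i, j, hiA, hjA, gfun_sub f i j A fun B' _ hB' hi' => ?_⟩
    rcases f.2 B B' hB hB' with h | h
    · exact h hjB
    · exact absurd (h hi') hiB

lemma gfun_upper (f : K (BQ O)) (A : BQ O) (hA : f.1 A ≠ 0) (i j : O) (hi : i ∈ A.1)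
    (hj : j ∉ A.1) : gfun f j + f.1 A ≤ gfun f i := by
  classical
  have : f.1 A = ∑ B, if B = A then f.1 B else 0 := by simp
  unfold gfun
  rw [this, ← Finset.sum_add_distrib]
  refine Finset.sum_le_sum fun B _ => ?_
  have h0 : 0 ≤ f.1 B := by simp
  by_cases hB : f.1 B = 0
  · simp [hB]
  · by_cases hBA : B = A
    · subst hBA
      simp [hi, hj]
    · by_cases hjB : j ∈ B.1
      · have : i ∈ B.1 := by
          rcases f.2 A B hA hB with h | h
          · exact h hi
          · exact absurd (h hjB) hj
        simp [hjB, hBA, this]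
      · simp only [hjB, hBA, if_false, add_zero]
        split_ifs <;> simp

lemma gfun_le (f f' : K (BQ O)) (h : gfun f = gfun f') (A : BQ O) : f.1 A ≤ f'.1 A := by
  by_cases hA : f.1 A = 0
  · rw [hA]; simp
  · obtain ⟨i, j, hi, hj, hij⟩ := gfun_lower f' A
    have := gfun_upper f A hA i j hi hj
    rw [h] at this
    linarith

noncomputable def gmap : C(K (BQ O), Y O) where
  toFun f := ⟨gfun f, gfun_mem f⟩
  continuous_toFun := by
    classical
    refine Continuous.subtype_mk (continuous_pi fun i => continuous_finsetSum _ fun A _ => ?_) _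
    split_ifs
    · exact continuous_eval A
    · exact continuous_const

lemma gmap_injective : Function.Injective (gmap (O := O)) := by
  intro f f' h
  have h' : gfun f = gfun f' := congrArg Subtype.val h
  apply Subtype.ext
  apply stdSimplex.ext
  funext A
  exact le_antisymm (gfun_le f f' h' A) (gfun_le f' f h'.symm A)

def lev (y : O → ℝ) (A : Set O) : Set ℝ := {l | l ∈ Set.Ioc (0 : ℝ) 1 ∧ {i | l ≤ y i} = A}

lemma lev_meas (y : O → ℝ) (A : Set O) : MeasurableSet (lev y A) := by
  have : lev y A = Set.Ioc 0 1 ∩ ⋂ i, {l | l ≤ y i ↔ i ∈ A} := by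
    ext l
    simp [lev, Set.ext_iff]
  rw [this]
  refine measurableSet_Ioc.inter (MeasurableSet.iInter fun i => ?_)
  by_cases h : i ∈ A
  · simp only [h, iff_true]; exact measurableSet_Iic
  · simp only [h, iff_false, not_le]; exact measurableSet_Ioi

lemma lev_sum (y : Y O) (p : BQ O → Prop) [DecidablePred p] :
    (∑ A : BQ O, if p A then volume.real (lev y.1 A.1) else 0) =
      volume.real (⋃ A ∈ Finset.univ.filter p, lev y.1 A.1) := by
  rw [measureReal_biUnion_finset (h := fun A _ => ne_top_of_le_ne_top (by simp)
    (measure_mono (t := Set.Ioc (0 : ℝ) 1) fun l hl => hl.1))]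
  · rw [Finset.sum_filter]
  · intro A _ B _ hAB
    refine Set.disjoint_left.2 fun l h1 h2 => hAB (Subtype.ext ?_)
    rw [← h1.2, ← h2.2]
  · intro A _
    exact lev_meas _ _

lemma lev_mem (y : Y O) (l : ℝ) (hl : l ∈ Set.Ioc (0 : ℝ) 1) :
    {i | l ≤ y.1 i} ≠ ∅ ∧ {i | l ≤ y.1 i} ≠ Set.univ := by
  obtain ⟨-, ⟨i, hi⟩, ⟨j, hj⟩⟩ := y.2
  constructor
  · exact Set.nonempty_iff_ne_empty.1 ⟨j, by simp [hj, hl.2]⟩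
  · rw [Set.ne_univ_iff_exists_notMem]
    exact ⟨i, by simp [hi, hl.1]⟩

lemma gmap_surjective : Function.Surjective (gmap (O := O)) := by
  classical
  intro y
  let f₀ : stdSimplex ℝ (BQ O) := ⟨fun A => volume.real (lev y.1 A.1), fun A => measureReal_nonneg, by
    have := lev_sum y (fun _ => True)
    simp only [if_true] at this
    rw [this]
    have : (⋃ A ∈ Finset.univ.filter (fun _ : BQ O => True), lev y.1 A.1) = Set.Ioc 0 1 := by
      ext l
      simp only [Finset.filter_true, Finset.mem_univ, Set.iUnion_true, Set.mem_iUnion]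
      constructor
      · rintro ⟨A, hA⟩
        exact hA.1
      · intro hl
        exact ⟨⟨_, lev_mem y l hl⟩, hl, rfl⟩
    rw [this]
    simp⟩
  have hne : ∀ A, f₀ A ≠ 0 → ∃ l, {i | l ≤ y.1 i} = A.1 := by
    intro A hA
    have : (lev y.1 A.1).Nonempty := by
      by_contra h
      rw [Set.not_nonempty_iff_eq_empty] at h
      apply hA
      show volume.real (lev y.1 A.1) = 0
      simp [h]
    obtain ⟨l, hl⟩ := this
    exact ⟨l, hl.2⟩
  let f : K (BQ O) := ⟨f₀, fun A B hA hB => by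
    obtain ⟨l, hl⟩ := hne A hA
    obtain ⟨l', hl'⟩ := hne B hB
    rcases le_total l l' with h | h
    · right
      show B.1 ⊆ A.1
      rw [← hl, ← hl']
      exact fun i hi => h.trans hi
    · left
      show A.1 ⊆ B.1
      rw [← hl, ← hl']
      exact fun i hi => h.trans hi⟩
  refine ⟨f, Subtype.ext ?_⟩
  funext i
  show gfun f i = y.1 i
  have h1 := lev_sum y (fun A => i ∈ A.1)
  have h2 : (⋃ A ∈ Finset.univ.filter (fun A : BQ O => i ∈ A.1), lev y.1 A.1) =
      Set.Ioc 0 (y.1 i) := by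
    ext l
    simp only [Finset.mem_filter, Finset.mem_univ, true_and, Set.mem_iUnion]
    constructor
    · rintro ⟨A, hiA, hA⟩
      refine ⟨hA.1.1, ?_⟩
      rw [← hA.2] at hiA
      exact hiA
    · intro hl
      have hl' : l ∈ Set.Ioc (0 : ℝ) 1 := ⟨hl.1, hl.2.trans (y.2.1 i).2⟩
      exact ⟨⟨_, lev_mem y l hl'⟩, hl.2, hl', rfl⟩
  rw [h2] at h1
  have h3 : volume.real (Set.Ioc 0 (y.1 i)) = y.1 i := by
    simp [(y.2.1 i).1]
  rw [h3] at h1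
  exact h1

noncomputable def BHomeo : K (BQ O) ≃ₜ Y O :=
  haveI : CompactSpace (K (BQ O)) :=
    haveI := compact_real (BQ O)
    (realHomeo (BQ O)).compactSpace
  Continuous.homeoOfEquivCompactToT2
    (f := Equiv.ofBijective gmap ⟨gmap_injective, gmap_surjective⟩) gmap.continuous
end
end RackOrder
namespace RackOrder
section
variable {n : ℕ}

noncomputable def mx (v : Fin (n + 1) → ℝ) : ℝ := Finset.univ.sup' Finset.univ_nonempty v
noncomputable def mn (v : Fin (n + 1) → ℝ) : ℝ := Finset.univ.inf' Finset.univ_nonempty v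

lemma le_mx (v : Fin (n + 1) → ℝ) (i) : v i ≤ mx v := Finset.le_sup' v (Finset.mem_univ i)
lemma mn_le (v : Fin (n + 1) → ℝ) (i) : mn v ≤ v i := Finset.inf'_le v (Finset.mem_univ i)
lemma exists_mx (v : Fin (n + 1) → ℝ) : ∃ i, v i = mx v := by
  obtain ⟨i, -, h⟩ := Finset.exists_mem_eq_sup' Finset.univ_nonempty v
  exact ⟨i, h.symm⟩
lemma exists_mn (v : Fin (n + 1) → ℝ) : ∃ i, v i = mn v := by
  obtain ⟨i, -, h⟩ := Finset.exists_mem_eq_inf' Finset.univ_nonempty v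
  exact ⟨i, h.symm⟩

lemma continuous_mx : Continuous (mx (n := n)) :=
  Continuous.finset_sup'_apply _ fun i _ => continuous_apply i
lemma continuous_mn : Continuous (mn (n := n)) :=
  Continuous.finset_inf'_apply _ fun i _ => continuous_apply i

abbrev Sph (n : ℕ) := Metric.sphere (0 : EuclideanSpace ℝ (Fin n)) 1

def Lz (z : EuclideanSpace ℝ (Fin n)) : Fin (n + 1) → ℝ := Fin.cons 0 (fun i => z i)

lemma continuous_Lz : Continuous (Lz (n := n)) := by
  refine continuous_pi fun i => ?_
  refine Fin.cases ?_ (fun j => ?_) i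
  · exact continuous_const
  · simp only [Lz, Fin.cons_succ]; fun_prop

lemma Lz_lt (z : Sph n) : mn (Lz z.1) < mx (Lz z.1) := by
  by_contra! h
  have hz : z.1 = 0 := by
    ext i
    have h1 := le_mx (Lz z.1) i.succ
    have h2 := mn_le (Lz z.1) i.succ
    have h3 := le_mx (Lz z.1) 0
    have h4 := mn_le (Lz z.1) 0
    simp only [Lz, Fin.cons_succ, Fin.cons_zero] at h1 h2 h3 h4 h
    simp only [PiLp.zero_apply]
    linarith
  have := z.2
  rw [hz] at this
  simp at this

noncomputable def toY (z : Sph n) : Y (Fin (n + 1)) :=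
  ⟨fun i => (Lz z.1 i - mn (Lz z.1)) / (mx (Lz z.1) - mn (Lz z.1)), by
    have h := Lz_lt z
    have h' : 0 < mx (Lz z.1) - mn (Lz z.1) := by linarith
    refine ⟨fun i => ⟨?_, ?_⟩, ?_, ?_⟩
    · have := mn_le (Lz z.1) i
      exact div_nonneg (by linarith) h'.le
    · have := le_mx (Lz z.1) i
      rw [div_le_one h']
      linarith
    · obtain ⟨i, hi⟩ := exists_mn (Lz z.1)
      exact ⟨i, by simp [hi]⟩
    · obtain ⟨i, hi⟩ := exists_mx (Lz z.1)
      exact ⟨i, by simp only [hi]; exact div_self h'.ne'⟩⟩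

lemma continuous_toY : Continuous (toY (n := n)) := by
  have hL : Continuous (fun z : Sph n => Lz z.1) := continuous_Lz.comp continuous_subtype_val
  refine Continuous.subtype_mk (continuous_pi fun i => ?_) _
  refine Continuous.div (((continuous_apply i).comp hL).sub (continuous_mn.comp hL))
    ((continuous_mx.comp hL).sub (continuous_mn.comp hL)) fun z => ?_
  have := Lz_lt z
  exact (sub_pos.2 this).ne'

noncomputable def Dy (y : Fin (n + 1) → ℝ) : EuclideanSpace ℝ (Fin n) :=
  WithLp.toLp 2 fun i => y i.succ - y 0

lemma Dy_apply (y : Fin (n + 1) → ℝ) (i : Fin n) : Dy y i = y i.succ - y 0 := rfl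

lemma Dy_ne (y : Y (Fin (n + 1))) : Dy y.1 ≠ 0 := by
  intro h
  have h0 : ∀ i, y.1 i = y.1 0 := by
    intro i
    refine Fin.cases rfl (fun j => ?_) i
    have := Dy_apply y.1 j
    rw [h] at this
    simp only [PiLp.zero_apply] at this
    linarith
  obtain ⟨-, ⟨i, hi⟩, ⟨j, hj⟩⟩ := y.2
  have h1 := h0 i
  have h2 := h0 j
  linarith

lemma continuous_Dy : Continuous (Dy (n := n)) := by
  unfold Dy
  fun_prop

noncomputable def toS (y : Y (Fin (n + 1))) : Sph n :=
  ⟨‖Dy y.1‖⁻¹ • Dy y.1, by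
    have := Dy_ne y
    simp [norm_smul, this]⟩

lemma continuous_toS : Continuous (toS (n := n)) := by
  have hD : Continuous (fun y : Y (Fin (n + 1)) => Dy y.1) :=
    continuous_Dy.comp continuous_subtype_val
  refine Continuous.subtype_mk (Continuous.smul (hD.norm.inv₀ fun y => ?_) hD) _
  simpa using Dy_ne y

lemma toS_toY (z : Sph n) : toS (toY z) = z := by
  have h := sub_pos.2 (Lz_lt z)
  set r := mx (Lz z.1) - mn (Lz z.1) with hr
  have hD : Dy (toY z).1 = r⁻¹ • z.1 := by
    ext i
    rw [Dy_apply]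
    simp only [toY, PiLp.smul_apply, smul_eq_mul, ← hr]
    simp only [Lz, Fin.cons_succ, Fin.cons_zero]
    field_simp
    ring
  have hz : ‖z.1‖ = 1 := by simpa using z.2
  apply Subtype.ext
  show ‖Dy (toY z).1‖⁻¹ • Dy (toY z).1 = z.1
  rw [hD, norm_smul, hz, smul_smul, norm_inv, Real.norm_of_nonneg h.le]
  rw [mul_one, inv_inv, mul_inv_cancel₀ h.ne', one_smul]

lemma mx_affine (v : Fin (n + 1) → ℝ) (a b : ℝ) (ha : 0 ≤ a) :
    mx (fun i => a * v i + b) = a * mx v + b := by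
  apply le_antisymm
  · obtain ⟨i, hi⟩ := exists_mx (fun i => a * v i + b)
    rw [← hi]
    have := mul_le_mul_of_nonneg_left (le_mx v i) ha
    simpa using this
  · obtain ⟨i, hi⟩ := exists_mx v
    rw [← hi]
    exact le_mx (fun i => a * v i + b) i

lemma mn_affine (v : Fin (n + 1) → ℝ) (a b : ℝ) (ha : 0 ≤ a) :
    mn (fun i => a * v i + b) = a * mn v + b := by
  apply le_antisymm
  · obtain ⟨i, hi⟩ := exists_mn v
    rw [← hi]
    exact mn_le (fun i => a * v i + b) i
  · obtain ⟨i, hi⟩ := exists_mn (fun i => a * v i + b)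
    rw [← hi]
    have := mul_le_mul_of_nonneg_left (mn_le v i) ha
    simpa using this

lemma toY_toS (y : Y (Fin (n + 1))) : toY (toS y) = y := by
  have hpos : 0 < ‖Dy y.1‖⁻¹ := by simpa using Dy_ne y
  set r := ‖Dy y.1‖⁻¹ with hr
  have hL : Lz (toS y).1 = fun i => r * y.1 i + (- r * y.1 0) := by
    funext i
    refine Fin.cases ?_ (fun j => ?_) i
    · simp [Lz]
    · simp only [Lz, toS, Fin.cons_succ, PiLp.smul_apply, smul_eq_mul, Dy_apply, ← hr]
      ring
  obtain ⟨h0, ⟨i0, hi0⟩, ⟨i1, hi1⟩⟩ := y.2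
  have hmx : mx y.1 = 1 := by
    apply le_antisymm
    · obtain ⟨i, hi⟩ := exists_mx y.1
      rw [← hi]; exact (h0 i).2
    · have h := le_mx y.1 i1; linarith
  have hmn : mn y.1 = 0 := by
    apply le_antisymm
    · have h := mn_le y.1 i0; linarith
    · obtain ⟨i, hi⟩ := exists_mn y.1
      rw [← hi]; exact (h0 i).1
  apply Subtype.ext
  funext i
  simp only [toY]
  rw [hL, mx_affine _ _ _ hpos.le, mn_affine _ _ _ hpos.le, hmx, hmn]
  field_simp
  ring

noncomputable def sphHomeo : Y (Fin (n + 1)) ≃ₜ Sph n where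
  toFun := toS
  invFun := toY
  left_inv := toY_toS
  right_inv := toS_toY
  continuous_toFun := continuous_toS
  continuous_invFun := continuous_toY

theorem main_homotopy (P : Type) [PartialOrder P] [Fintype P]
    (c : P →o BQ (Fin (n + 1))) (e : BQ (Fin (n + 1)) →o P) (hce : ∀ q, c (e q) = q)
    (hec : ∀ p, p ≤ e (c p)) :
    Nonempty (ContinuousMap.HomotopyEquiv (orderComplexSpace10 P)
      (Metric.sphere (0 : EuclideanSpace ℝ (Fin n)) 1)) :=
  ⟨((realHomeo P).toHomotopyEquiv.trans (Kequiv c e hce hec)).trans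
    ((BHomeo.trans sphHomeo).toHomotopyEquiv)⟩
end
end RackOrder

namespace RackOrder
section
variable {X : Type} [Fintype X] {op : X → X → X}

lemma exists_orbit_map (hbij : ∀ a : X, Function.Bijective (op a)) (m : ℕ)
    (hm : m = Nat.card (MulAction.orbitRel.Quotient (InnRack10 op hbij) X)) :
    ∃ p : X → Fin m, Function.Surjective p ∧ (∀ a x, p (op a x) = p x) ∧
      ∀ S : Set X, (∀ a, op a '' S = S) → ∀ x y, p x = p y → x ∈ S → y ∈ S := by
  have : Finite (MulAction.orbitRel.Quotient (InnRack10 op hbij) X) :=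
    Quotient.finite _
  let E := Finite.equivFinOfCardEq hm.symm
  refine ⟨fun x => E (Quotient.mk _ x), E.surjective.comp Quotient.mk_surjective, ?_, ?_⟩
  · intro a x
    refine congrArg E (Quotient.sound ?_)
    show (MulAction.orbitRel (InnRack10 op hbij) X) _ _
    rw [MulAction.orbitRel_apply]
    exact ⟨⟨Equiv.ofBijective (op a) (hbij a), Subgroup.subset_closure ⟨a, rfl⟩⟩, rfl⟩
  · intro S hS x y hxy hx
    have h : (MulAction.orbitRel (InnRack10 op hbij) X) y x :=
      Quotient.exact (E.injective hxy).symm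
    rw [MulAction.orbitRel_apply] at h
    obtain ⟨⟨g, hg⟩, rfl⟩ := h
    show g x ∈ S
    have key : ∀ g ∈ InnRack10 op hbij, ∀ z, g z ∈ S ↔ z ∈ S := by
      intro g hg
      refine Subgroup.closure_induction (p := fun g _ => ∀ z, g z ∈ S ↔ z ∈ S)
        ?_ ?_ ?_ ?_ hg
      · rintro _ ⟨a, rfl⟩ z
        show op a z ∈ S ↔ z ∈ S
        conv_lhs => rw [← hS a]
        exact (hbij a).1.mem_set_image
      · intro z; rfl
      · intro g h _ _ ih1 ih2 z
        rw [Equiv.Perm.mul_apply, ih1, ih2]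
      · intro g _ ih z
        rw [← ih (g⁻¹ z)]; simp
    exact (key g hg x).2 hx

lemma preimage_subrack (hbij : ∀ a : X, Function.Bijective (op a)) {m : ℕ} {p : X → Fin m}
    (hp : ∀ a x, p (op a x) = p x) (A : Set (Fin m)) : IsSubrack10 op (p ⁻¹' A) := by
  intro a _
  refine ⟨fun x hx => ?_, (hbij a).1.injOn, fun y hy => ?_⟩
  · show p (op a x) ∈ A
    rw [hp]; exact hx
  · obtain ⟨x, rfl⟩ := (hbij a).2 y
    refine ⟨x, ?_, rfl⟩
    have h : p (op a x) ∈ A := hy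
    rw [hp] at h; exact h

lemma exists_max {S : Set X} (hS : IsSubrack10 op S) (hu : S ≠ Set.univ) :
    ∃ M, IsMaxProperSubrack10 op M ∧ S ⊆ M := by
  obtain ⟨M, hSM, hM⟩ := Set.Finite.exists_le_maximal
    (s := setOf fun T : Set X => IsSubrack10 op T ∧ T ≠ Set.univ) (Set.toFinite _) ⟨hS, hu⟩
  refine ⟨M, ⟨hM.prop.1, hM.prop.2, fun T hT hMT => ?_⟩, hSM⟩
  by_contra hTu
  exact hMT.2 (hM.2 ⟨hT, hTu⟩ hMT.1)

lemma max_iff (hbij : ∀ a : X, Function.Bijective (op a))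
    (hstab : ∀ M : Set X, IsMaxProperSubrack10 op M → ∀ a : X, op a '' M = M)
    {m : ℕ} {p : X → Fin m} (hsurj : Function.Surjective p) (hp : ∀ a x, p (op a x) = p x)
    (hinv : ∀ S : Set X, (∀ a, op a '' S = S) → ∀ x y, p x = p y → x ∈ S → y ∈ S)
    (M : Set X) : IsMaxProperSubrack10 op M ↔ ∃ o, M = p ⁻¹' {o}ᶜ := by
  have fwd : ∀ M, IsMaxProperSubrack10 op M → ∃ o, M = p ⁻¹' {o}ᶜ := by
    intro M hM
    obtain ⟨x, hx⟩ := (Set.ne_univ_iff_exists_notMem M).1 hM.2.1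
    refine ⟨p x, ?_⟩
    have hsub : M ⊆ p ⁻¹' {p x}ᶜ := fun y hy h =>
      hx (hinv M (hstab M hM) y x h hy)
    by_contra hne
    have h := hM.2.2 _ (preimage_subrack hbij hp {p x}ᶜ) (hsub.ssubset_of_ne hne)
    have hx' : x ∈ p ⁻¹' {p x}ᶜ := h ▸ Set.mem_univ x
    exact hx' rfl
  refine ⟨fwd M, ?_⟩
  rintro ⟨o, rfl⟩
  obtain ⟨x, rfl⟩ := hsurj o
  obtain ⟨N, hN, hsub⟩ := exists_max (preimage_subrack hbij hp {p x}ᶜ)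
    (fun h => (h ▸ Set.mem_univ x : x ∈ p ⁻¹' {p x}ᶜ) rfl)
  obtain ⟨o', rfl⟩ := fwd N hN
  obtain ⟨y, rfl⟩ := hsurj o'
  have hxy : p y = p x := by
    by_contra hne
    exact hsub (show y ∈ p ⁻¹' {p x}ᶜ from hne) rfl
  rw [← hxy]; exact hN

lemma image_ne_univ (hbij : ∀ a : X, Function.Bijective (op a))
    (hstab : ∀ M : Set X, IsMaxProperSubrack10 op M → ∀ a : X, op a '' M = M)
    {m : ℕ} {p : X → Fin m} (hsurj : Function.Surjective p) (hp : ∀ a x, p (op a x) = p x)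
    (hinv : ∀ S : Set X, (∀ a, op a '' S = S) → ∀ x y, p x = p y → x ∈ S → y ∈ S)
    {S : Set X} (hS : IsSubrack10 op S) (hu : S ≠ Set.univ) : p '' S ≠ Set.univ := by
  obtain ⟨M, hM, hSM⟩ := exists_max hS hu
  obtain ⟨o, rfl⟩ := (max_iff hbij hstab hsurj hp hinv M).1 hM
  intro h
  obtain ⟨x, hx, rfl⟩ := (h ▸ Set.mem_univ o : o ∈ p '' S)
  exact hSM hx rfl

lemma preimage_ne_empty {m : ℕ} {p : X → Fin m} (hsurj : Function.Surjective p)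
    {A : Set (Fin m)} (h : A ≠ ∅) : p ⁻¹' A ≠ ∅ := by
  rw [← Set.preimage_empty (f := p)]
  exact fun h' => h (hsurj.preimage_injective h')

lemma preimage_ne_univ {m : ℕ} {p : X → Fin m} (hsurj : Function.Surjective p)
    {A : Set (Fin m)} (h : A ≠ Set.univ) : p ⁻¹' A ≠ Set.univ := by
  rw [← Set.preimage_univ (f := p)]
  exact fun h' => h (hsurj.preimage_injective h')

lemma preimage_eq_sInter {m : ℕ} (p : X → Fin m) (A : Set (Fin m)) :
    p ⁻¹' A = ⋂₀ {N | ∃ o, o ∉ A ∧ N = p ⁻¹' {o}ᶜ} := by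
  ext x
  constructor
  · rintro hx _ ⟨o, ho, rfl⟩ h
    exact ho ((show p x = o from h) ▸ hx)
  · intro hx
    by_contra h
    exact hx _ ⟨p x, h, rfl⟩ rfl

end
end RackOrder

/-- Let `X` be a finite rack whose proper subrack poset is nonempty and
all of whose maximal proper subracks are stabilized by `Inn(X)`.  Then the poset
`Inf(R(X))` of nonempty proper subracks which are intersections of sets of maximal
proper subracks is isomorphic to the proper part of the Boolean lattice on `m`
elements, where `m` is the number of `Inn(X)`-orbits, and the order complex of the
poset of nonempty proper subracks of `X` is homotopy equivalent to the sphere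
`S^{m-2}` (realized as the unit sphere in `ℝ^{m-1}`). -/
theorem stmt_10 {X : Type} [Fintype X] (op : X → X → X)
    (hbij : ∀ a : X, Function.Bijective (op a))
    (hA1 : ∀ a b c : X, op a (op b c) = op (op a b) (op a c))
    (hne : ∃ S : Set X, IsSubrack10 op S ∧ S ≠ ∅ ∧ S ≠ Set.univ)
    (hstab : ∀ M : Set X, IsMaxProperSubrack10 op M → ∀ a : X, op a '' M = M)
    (m : ℕ) (hm : m = Nat.card (MulAction.orbitRel.Quotient (InnRack10 op hbij) X)) :
    Nonempty
      ({S : Set X // S ≠ ∅ ∧ S ≠ Set.univ ∧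
          ∃ M : Set (Set X), (∀ N ∈ M, IsMaxProperSubrack10 op N) ∧ S = ⋂₀ M} ≃o
        {s : Set (Fin m) // s ≠ ∅ ∧ s ≠ Set.univ}) ∧
    Nonempty (ContinuousMap.HomotopyEquiv
      (orderComplexSpace10
        {S : Set X // IsSubrack10 op S ∧ S ≠ ∅ ∧ S ≠ Set.univ})
      (Metric.sphere (0 : EuclideanSpace ℝ (Fin (m - 1))) 1)) := by
  obtain ⟨p, hsurj, hp, hinv⟩ := RackOrder.exists_orbit_map hbij m hm
  have hmax := RackOrder.max_iff hbij hstab hsurj hp hinv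
  have hsat : ∀ M : Set (Set X), (∀ N ∈ M, IsMaxProperSubrack10 op N) →
      p ⁻¹' (p '' (⋂₀ M)) = ⋂₀ M := by
    intro M hM
    apply Set.Subset.antisymm _ (Set.subset_preimage_image p _)
    rintro x ⟨y, hy, hxy⟩ N hN
    exact hinv N (hstab N (hM N hN)) y x hxy (hy N hN)
  constructor
  · refine ⟨OrderIso.symm ?_⟩
    refine RelIso.mk (Equiv.ofBijective
      (fun A => ⟨p ⁻¹' A.1, RackOrder.preimage_ne_empty hsurj A.2.1,
        RackOrder.preimage_ne_univ hsurj A.2.2, _, ?_, RackOrder.preimage_eq_sInter p A.1⟩)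
        ⟨?_, ?_⟩) ?_
    · rintro N ⟨o, -, rfl⟩
      exact (hmax _).2 ⟨o, rfl⟩
    · intro A B h
      exact Subtype.ext (hsurj.preimage_injective (congrArg Subtype.val h))
    · rintro ⟨S, h1, h2, M, hM, rfl⟩
      have hs := hsat M hM
      refine ⟨⟨p '' (⋂₀ M), ?_, ?_⟩, Subtype.ext hs⟩
      · intro h
        rw [h, Set.preimage_empty] at hs
        exact h1 hs.symm
      · intro h
        rw [h, Set.preimage_univ] at hs
        exact h2 hs.symm
    · intro A B
      exact hsurj.preimage_subset_preimage_iff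
  · obtain ⟨S0, -, hS0, -⟩ := hne
    obtain ⟨x0, -⟩ := Set.nonempty_iff_ne_empty.2 hS0
    clear hm
    obtain ⟨n, rfl⟩ : ∃ n, m = n + 1 :=
      Nat.exists_eq_succ_of_ne_zero (fun h => by subst h; exact (p x0).elim0)
    classical
    have : Fintype {S : Set X // IsSubrack10 op S ∧ S ≠ ∅ ∧ S ≠ Set.univ} := Fintype.ofFinite _
    exact RackOrder.main_homotopy (n := n) _
      ⟨fun S => ⟨p '' S.1, fun h => S.2.2.1 (Set.image_eq_empty.1 h),
        RackOrder.image_ne_univ hbij hstab hsurj hp hinv S.2.1 S.2.2.2⟩,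
        fun S T h => Set.image_mono h⟩
      ⟨fun A => ⟨p ⁻¹' A.1, RackOrder.preimage_subrack hbij hp A.1,
        RackOrder.preimage_ne_empty hsurj A.2.1, RackOrder.preimage_ne_univ hsurj A.2.2⟩,
        fun A B h => Set.preimage_mono h⟩
      (fun A => Subtype.ext (Set.image_preimage_eq A.1 hsurj))
      (fun S => Set.subset_preimage_image p S.1)
end
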